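/- Let T be a linear involution without connection and let w be a nonempty word in its natural coding L(T). Set K_w = I_{w⁻¹} ∪ σ₂(I_{w⁻¹}). Then the set of mixed first return words to w is exactly the set of prefixes of length ρ_{K_w}(z) of the infinite natural coding Σ_T(z) of points z ∈ K_w (for z ∈ K_w ∖ Ô), where ρ_{K_w}(z) = inf{n ≥ 1 : Tⁿ(z) ∈ K_w} is the return time to K_w. -/

import Mathlib

open Set

namespace LinInv

/-- A letter of the extended alphabet `A ∪ A⁻¹`, encoded as a pair of a letter
of `A` and a sign. -/
abbrev Letter (A : Type*) := A × Bool

/-- The formal inverse of a letter. -/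
def Letter.inv {A : Type*} (c : Letter A) : Letter A := (c.1, !c.2)

/-- The inverse of a word over `A ∪ A⁻¹`. -/
def wordInv {A : Type*} (u : List (Letter A)) : List (Letter A) :=
  (u.map Letter.inv).reverse

/-- The involution `σ₂` exchanging the two components of `Î = I × {0,1}`. -/
def s2 (z : ℝ × Bool) : ℝ × Bool := (z.1, !z.2)

/-- A linear involution on the alphabet `A`: the open interval `I = ]lo,hi[`,
for each `c ∈ A ∪ A⁻¹` an open subinterval `I_c = ]endLo c, endHi c[ × {comp c}`
of one of the two components of `Î = I × {0,1}`, the finite set `Sig` of division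
points, and the first involution `σ₁`, subject to the defining conditions. -/
structure LinearInvolution (A : Type*) [Fintype A] where
  lo : ℝ
  hi : ℝ
  lo_lt_hi : lo < hi
  endLo : Letter A → ℝ
  endHi : Letter A → ℝ
  end_lt : ∀ c, endLo c < endHi c
  comp : Letter A → Bool
  sub_lo : ∀ c, lo ≤ endLo c
  sub_hi : ∀ c, endHi c ≤ hi
  /-- the length data satisfy `λ_a = λ_{a⁻¹}` -/
  len_inv : ∀ c, endHi c - endLo c = endHi (Letter.inv c) - endLo (Letter.inv c)
  /-- the set of division points -/
  Sig : Set (ℝ × Bool)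
  Sig_sub : Sig ⊆ Ioo lo hi ×ˢ (univ : Set Bool)
  /-- there are `2k-2` division points -/
  Sig_card : Sig.ncard = 2 * Fintype.card A - 2
  /-- the intervals `I_c` are pairwise disjoint -/
  disj : ∀ c d : Letter A, c ≠ d →
    Disjoint (Ioo (endLo c) (endHi c) ×ˢ ({comp c} : Set Bool))
      (Ioo (endLo d) (endHi d) ×ˢ ({comp d} : Set Bool))
  Sig_disj : ∀ c : Letter A,
    Disjoint Sig (Ioo (endLo c) (endHi c) ×ˢ ({comp c} : Set Bool))
  /-- the intervals `I_c` partition `Î` minus the division points -/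
  cover : Ioo lo hi ×ˢ (univ : Set Bool) =
    (⋃ c : Letter A, Ioo (endLo c) (endHi c) ×ˢ ({comp c} : Set Bool)) ∪ Sig
  /-- the first involution `σ₁` (as a total map; only its values on `Î ∖ Σ` matter) -/
  s1 : ℝ × Bool → ℝ × Bool
  s1_invol : ∀ z ∈ (Ioo lo hi ×ˢ (univ : Set Bool)) \ Sig, s1 (s1 z) = z
  /-- on each `I_c`, `σ₁` is either a translation or a symmetry -/
  s1_iso : ∀ c : Letter A,
    (∃ α : ℝ, ∀ z ∈ Ioo (endLo c) (endHi c) ×ˢ ({comp c} : Set Bool),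
        s1 z = (z.1 + α, comp (Letter.inv c))) ∨
    (∃ α : ℝ, ∀ z ∈ Ioo (endLo c) (endHi c) ×ˢ ({comp c} : Set Bool),
        s1 z = (-z.1 + α, comp (Letter.inv c)))
  /-- `σ₁` maps `I_c` onto `I_{c⁻¹}` -/
  s1_image : ∀ c : Letter A,
    s1 '' (Ioo (endLo c) (endHi c) ×ˢ ({comp c} : Set Bool)) =
      Ioo (endLo (Letter.inv c)) (endHi (Letter.inv c)) ×ˢ
        ({comp (Letter.inv c)} : Set Bool)

namespace LinearInvolution

variable {A : Type*} [Fintype A] (L : LinearInvolution A)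

/-- The domain `Î = I × {0,1}`. -/
def Ihat : Set (ℝ × Bool) := Ioo L.lo L.hi ×ˢ (univ : Set Bool)

/-- The interval `I_c` associated with the letter `c ∈ A ∪ A⁻¹`. -/
def Ia (c : Letter A) : Set (ℝ × Bool) :=
  Ioo (L.endLo c) (L.endHi c) ×ˢ ({L.comp c} : Set Bool)

/-- The linear involution `T = σ₂ ∘ σ₁`. -/
def T (z : ℝ × Bool) : ℝ × Bool := s2 (L.s1 z)

/-- `O = ⋃_{n ≥ 0} T⁻ⁿ(Σ)`, the negative orbit of the singular points. -/
def O : Set (ℝ × Bool) := ⋃ n : ℕ, (L.T)^[n] ⁻¹' L.Sig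

/-- `Ô = O ∪ σ₂(O)`. -/
def Ohat : Set (ℝ × Bool) := L.O ∪ s2 '' L.O

/-- `T` has a connection if some singularity `x` of `T⁻¹` reaches a singularity
`y` of `T` in `n ≥ 0` steps. -/
def HasConnection : Prop := ∃ x ∈ s2 '' L.Sig, ∃ n : ℕ, (L.T)^[n] x ∈ L.Sig

/-- `T` is nonorientable if some `I_c` and `I_{c⁻¹}` lie in the same component. -/
def Nonorientable : Prop := ∃ c : Letter A, L.comp c = L.comp (Letter.inv c)

/-- `T` is orientable if it is not nonorientable. -/
def Orientable : Prop := ¬ L.Nonorientable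

/-- `u` occurs in the natural coding of the orbit of `z` at position `m`. -/
def IsCodingFrom (z : ℝ × Bool) (m : ℕ) (u : List (Letter A)) : Prop :=
  ∀ i : Fin u.length, (L.T)^[m + i.1] z ∈ L.Ia (u.get i)

/-- The natural coding `L(T)`: the set of factors of the infinite natural
codings `Σ_T(z)` for `z ∈ Î ∖ Ô`. -/
def lang : Set (List (Letter A)) :=
  {u | ∃ z ∈ L.Ihat \ L.Ohat, ∃ m : ℕ, L.IsCodingFrom z m u}

/-- The interval `I_w = I_{a₀} ∩ T⁻¹(I_{a₁}) ∩ ⋯ ∩ T^{-m+1}(I_{a_{m-1}})`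
associated with a word `w = a₀a₁⋯a_{m-1}`; by convention `I_ε = Î`. -/
def Iw (u : List (Letter A)) : Set (ℝ × Bool) :=
  L.Ihat ∩ ⋂ i : Fin u.length, (L.T)^[i.1] ⁻¹' L.Ia (u.get i)

/-- The return time `ρ_X(x) = inf {n ≥ 1 ∣ Tⁿ(x) ∈ X}`, with value `∞` if the
orbit of `x` never returns to `X`. -/
noncomputable def retTime (X : Set (ℝ × Bool)) (x : ℝ × Bool) : ℕ∞ :=
  sInf {n : ℕ∞ | ∃ m : ℕ, n = (m : ℕ∞) ∧ 1 ≤ m ∧ (L.T)^[m] x ∈ X}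

/-- A word is even if it has an even number of odd letters (a letter `a` is odd
when `I_a` and `I_{a⁻¹}` lie in the same component). -/
def EvenWord (u : List (Letter A)) : Prop :=
  Even (u.countP fun c => L.comp (c.1, true) == L.comp (c.1, false))

/-- The morphism `F_A → ℤ/2ℤ` sending each odd letter to `1` and each even
letter to `0`. -/
noncomputable def evenHom : FreeGroup A →* Multiplicative (ZMod 2) :=
  FreeGroup.lift fun a =>
    Multiplicative.ofAdd (if L.comp (a, true) = L.comp (a, false) then (1 : ZMod 2) else 0)

/-- The even group: the subgroup of `F_A` formed by the even elements. -/
noncomputable def evenGroup : Subgroup (FreeGroup A) := (L.evenHom).ker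

/-- The admissibility condition at an endpoint `x` of an interval `J`:
either `x = Tⁿ(z)` for a singularity `z` of `T⁻¹` with `T^k(z) ∉ J` for
`0 ≤ k ≤ n`, or `Tⁿ(x) = z` for a singularity `z` of `T` with `T^k(x) ∉ J`
for `0 ≤ k ≤ n`. -/
def AdmissibleEndpoint (J : Set (ℝ × Bool)) (x : ℝ × Bool) : Prop :=
  (∃ z ∈ s2 '' L.Sig, ∃ n : ℕ, (L.T)^[n] z = x ∧ ∀ k ≤ n, (L.T)^[k] z ∉ J) ∨
  (∃ z ∈ L.Sig, ∃ n : ℕ, (L.T)^[n] x = z ∧ ∀ k ≤ n, (L.T)^[k] x ∉ J)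

/-- The open interval `]u,v[ × {δ}` is admissible with respect to `T`. -/
def AdmissibleInterval (u v : ℝ) (δ : Bool) : Prop :=
  u < v ∧ L.AdmissibleEndpoint (Ioo u v ×ˢ ({δ} : Set Bool)) (u, δ) ∧
    L.AdmissibleEndpoint (Ioo u v ×ˢ ({δ} : Set Bool)) (v, δ)

end LinearInvolution

/-- A set of words is factorial if it contains the factors of its elements. -/
def FactorialSet {α : Type*} (S : Set (List α)) : Prop :=
  ∀ u ∈ S, ∀ v : List α, v <:+: u → v ∈ S

/-- A word over `A ∪ A⁻¹` is reduced if it has no factor `c c⁻¹`. -/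
def Reduced {A : Type*} (u : List (Letter A)) : Prop :=
  u.Chain' fun c d => d ≠ Letter.inv c

/-- A laminary set on `A`: a symmetric factorial set of reduced words on
`A ∪ A⁻¹`. -/
def Laminary {A : Type*} (S : Set (List (Letter A))) : Prop :=
  FactorialSet S ∧ (∀ u ∈ S, wordInv u ∈ S) ∧ ∀ u ∈ S, Reduced u

/-- A laminary set is orientable if it splits as `S₊ ∪ S₋` with `S₊, S₋`
factorial, `S₊ ∩ S₋ = {ε}`, and `x ∈ S₋ ↔ x⁻¹ ∈ S₊`. -/
def OrientableSet {A : Type*} (S : Set (List (Letter A))) : Prop :=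
  ∃ Sp Sm : Set (List (Letter A)), FactorialSet Sp ∧ FactorialSet Sm ∧
    S = Sp ∪ Sm ∧ Sp ∩ Sm = {([] : List (Letter A))} ∧
    ∀ x ∈ S, (x ∈ Sm ↔ wordInv x ∈ Sp)

/-- A set of words is uniformly recurrent if it is right extendable and every
`u ∈ S` occurs in every long enough word of `S`. -/
def UniformlyRecurrent {α : Type*} (S : Set (List α)) : Prop :=
  (∀ u ∈ S, ∃ c : α, u ++ [c] ∈ S) ∧
  ∀ u ∈ S, ∃ n : ℕ, 1 ≤ n ∧ ∀ w ∈ S, w.length = n → u <:+: w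

/-- A set of words over `A ∪ A⁻¹` is uniformly semi-recurrent if it is right
extendable and for every `u ∈ S`, every long enough word of `S` contains `u` or
`u⁻¹` as a factor. -/
def UniformlySemiRecurrent {A : Type*} (S : Set (List (Letter A))) : Prop :=
  (∀ u ∈ S, ∃ c : Letter A, u ++ [c] ∈ S) ∧
  ∀ u ∈ S, ∃ n : ℕ, 1 ≤ n ∧ ∀ w ∈ S, w.length = n → (u <:+: w ∨ wordInv u <:+: w)

/-- A laminary set is semi-recurrent if for all `u, w ∈ S` there is `v ∈ S`
with `uvw ∈ S` or `uvw⁻¹ ∈ S`. -/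
def SemiRecurrent {A : Type*} (S : Set (List (Letter A))) : Prop :=
  ∀ u ∈ S, ∀ w ∈ S, ∃ v ∈ S, u ++ v ++ w ∈ S ∨ u ++ v ++ wordInv w ∈ S

/-- A complete return word to `X ⊆ S`: a word of `S` with a proper prefix in
`X` and a proper suffix in `X`. -/
def CompleteReturnWord {α : Type*} (S X : Set (List α)) (u : List α) : Prop :=
  u ∈ S ∧ (∃ p ∈ X, p <+: u ∧ p ≠ u) ∧ (∃ s ∈ X, s <:+ u ∧ s ≠ u)

/-- A complete first return word to `X`: a complete return word to `X` with no
internal factor in `X`. -/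
def CompleteFirstReturnWord {α : Type*} (S X : Set (List α)) (u : List α) : Prop :=
  CompleteReturnWord S X u ∧
    ¬ ∃ p v s : List α, u = p ++ v ++ s ∧ v ∈ X ∧ p ≠ [] ∧ s ≠ []

/-- `CR S w`: the set of complete first return words to `{w, w⁻¹}` in `S`. -/
def CR {A : Type*} (S : Set (List (Letter A))) (w : List (Letter A)) :
    Set (List (Letter A)) :=
  {u | CompleteFirstReturnWord S {w, wordInv w} u}

open Classical in
/-- The operation `N` on complete return words to `{w, w⁻¹}`: erase the prefix
`w` if present, and erase the suffix `w⁻¹` if present. -/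
noncomputable def NN {A : Type*} (w u : List (Letter A)) : List (Letter A) :=
  let u' := if w <+: u then u.drop w.length else u
  if wordInv w <:+ u' then u'.take (u'.length - w.length) else u'

/-- `MR S w`: the set of mixed first return words to `w` in `S`. -/
noncomputable def MR {A : Type*} (S : Set (List (Letter A))) (w : List (Letter A)) :
    Set (List (Letter A)) :=
  NN w '' CR S w

/-- `RightReturn S w`: the set of first right return words to `w` in `S`,
i.e. the words `u` such that `wu` is a complete first return word to `{w}`. -/
def RightReturn {α : Type*} (S : Set (List α)) (w : List α) : Set (List α) :=
  {u | CompleteFirstReturnWord S {w} (w ++ u)}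

/-- `X` is a basis (free generating set) of the subgroup `H`: the canonical map
`FreeGroup X → G` is injective with range `H`. -/
def IsBasisOf {G : Type*} [Group G] (X : Set G) (H : Subgroup G) : Prop :=
  Function.Injective (FreeGroup.lift (fun x : X => (x : G))) ∧
    (FreeGroup.lift (fun x : X => (x : G)) : FreeGroup X →* G).range = H

/-- `Y` is a symmetric basis of `H` if `Y = X ∪ X⁻¹` for some basis `X` of `H`. -/
def IsSymmetricBasisOf {G : Type*} [Group G] (Y : Set G) (H : Subgroup G) : Prop :=
  ∃ X : Set G, IsBasisOf X H ∧ Y = X ∪ X⁻¹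

/-- The prime words in `S` with respect to a subgroup `G` of `F_A`: the
nonempty words of `G ∩ S` without a proper nonempty prefix in `G ∩ S`. -/
def PrimeWords {A : Type*} (S : Set (List (Letter A))) (G : Subgroup (FreeGroup A)) :
    Set (List (Letter A)) :=
  {u | u ∈ S ∧ u ≠ [] ∧ FreeGroup.mk u ∈ G ∧
    ∀ p : List (Letter A), p <+: u → p ≠ [] → p ≠ u → ¬(p ∈ S ∧ FreeGroup.mk p ∈ G)}

theorem s2_s2 (z : ℝ × Bool) : s2 (s2 z) = z := by simp [s2]

theorem length_wordInv {A : Type*} (u : List (Letter A)) : (wordInv u).length = u.length := by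
  simp [wordInv]

theorem wordInv_wordInv {A : Type*} (u : List (Letter A)) : wordInv (wordInv u) = u := by
  have : (Letter.inv ∘ Letter.inv : Letter A → Letter A) = id := by
    funext c; simp [Letter.inv]
  simp [wordInv, List.map_reverse, this]

namespace LinearInvolution

variable {A : Type*} [Fintype A] (L : LinearInvolution A)

/-- The infinite natural coding of `z` starts with `u`. -/
def Codes (z : ℝ × Bool) (u : List (Letter A)) : Prop :=
  ∀ i (h : i < u.length), (L.T)^[i] z ∈ L.Ia u[i]

variable {L}

theorem s2_mem_Ihat {z : ℝ × Bool} (hz : z ∈ L.Ihat) : s2 z ∈ L.Ihat := by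
  simpa [Ihat, s2] using hz

theorem Ia_subset_Ihat (c : Letter A) : L.Ia c ⊆ L.Ihat := by
  intro z hz
  have := L.cover
  unfold Ihat
  rw [this]
  exact Or.inl (mem_iUnion.2 ⟨c, hz⟩)

theorem notMem_Sig_of_mem_Ia {c : Letter A} {z : ℝ × Bool} (hz : z ∈ L.Ia c) : z ∉ L.Sig :=
  fun h => Set.disjoint_left.1 (L.Sig_disj c) h hz

theorem exists_mem_Ia {z : ℝ × Bool} (hz : z ∈ L.Ihat) (hs : z ∉ L.Sig) : ∃ c, z ∈ L.Ia c := by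
  unfold Ihat at hz
  rw [L.cover] at hz
  rcases hz with h | h
  · exact mem_iUnion.1 h
  · exact absurd h hs

theorem Ia_unique {c d : Letter A} {z : ℝ × Bool} (hc : z ∈ L.Ia c) (hd : z ∈ L.Ia d) :
    c = d := by
  by_contra h
  exact Set.disjoint_left.1 (L.disj c d h) hc hd

theorem s2_notMem_Ia {c : Letter A} {z : ℝ × Bool} (hc : z ∈ L.Ia c) : s2 z ∉ L.Ia c := by
  intro h
  have h1 : z.2 = L.comp c := hc.2
  have h2 : (!z.2) = L.comp c := h.2
  rw [← h1] at h2
  simp at h2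

theorem s1_mem_Ia {c : Letter A} {z : ℝ × Bool} (hc : z ∈ L.Ia c) :
    L.s1 z ∈ L.Ia (Letter.inv c) := by
  unfold Ia
  rw [← L.s1_image c]
  exact mem_image_of_mem _ hc

theorem s2_T (z : ℝ × Bool) : s2 (L.T z) = L.s1 z := s2_s2 _

theorem T_s2_T {c : Letter A} {z : ℝ × Bool} (hc : z ∈ L.Ia c) : L.T (s2 (L.T z)) = s2 z := by
  rw [s2_T, T, L.s1_invol z ⟨Ia_subset_Ihat c hc, notMem_Sig_of_mem_Ia hc⟩]

theorem mem_O_iff (z : ℝ × Bool) : z ∈ L.O ↔ ∃ n, (L.T)^[n] z ∈ L.Sig := by simp [O]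

theorem mem_Ohat_iff (z : ℝ × Bool) : z ∈ L.Ohat ↔ z ∈ L.O ∨ s2 z ∈ L.O := by
  refine or_congr Iff.rfl ⟨?_, fun h => ⟨_, h, s2_s2 z⟩⟩
  rintro ⟨y, hy, rfl⟩
  rwa [s2_s2]

theorem exists_mem_Ia_of_regular {z : ℝ × Bool} (hz : z ∈ L.Ihat \ L.Ohat) :
    ∃ c, z ∈ L.Ia c := by
  refine exists_mem_Ia hz.1 fun h => hz.2 ?_
  exact Or.inl ((mem_O_iff z).2 ⟨0, h⟩)

theorem s2_regular {z : ℝ × Bool} (hz : z ∈ L.Ihat \ L.Ohat) : s2 z ∈ L.Ihat \ L.Ohat := by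
  refine ⟨s2_mem_Ihat hz.1, fun h => hz.2 ?_⟩
  rw [mem_Ohat_iff, s2_s2] at h
  exact (mem_Ohat_iff z).2 h.symm

theorem T_regular {z : ℝ × Bool} (hz : z ∈ L.Ihat \ L.Ohat) : L.T z ∈ L.Ihat \ L.Ohat := by
  obtain ⟨c, hc⟩ := exists_mem_Ia_of_regular hz
  refine ⟨s2_mem_Ihat (Ia_subset_Ihat _ (s1_mem_Ia hc)), fun h => hz.2 ?_⟩
  rw [mem_Ohat_iff] at h ⊢
  simp only [mem_O_iff] at h ⊢
  rcases h with ⟨n, h⟩ | ⟨n, h⟩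
  · exact Or.inl ⟨n + 1, h⟩
  · cases n with
    | zero =>
      rw [Function.iterate_zero_apply, s2_T] at h
      exact absurd h (notMem_Sig_of_mem_Ia (s1_mem_Ia hc))
    | succ n =>
      rw [Function.iterate_succ_apply, T_s2_T hc] at h
      exact Or.inr ⟨n, h⟩

theorem iterate_regular {z : ℝ × Bool} (hz : z ∈ L.Ihat \ L.Ohat) (n : ℕ) :
    (L.T)^[n] z ∈ L.Ihat \ L.Ohat := by
  induction n with
  | zero => exact hz
  | succ n ih => rw [Function.iterate_succ_apply']; exact T_regular ih

/-- Conjugation by `σ₂` reverses the dynamics. -/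
theorem iterate_s2_iterate {z : ℝ × Bool} (hz : z ∈ L.Ihat \ L.Ohat) (j k : ℕ) :
    (L.T)^[j] (s2 ((L.T)^[k + j] z)) = s2 ((L.T)^[k] z) := by
  induction j with
  | zero => rfl
  | succ j ih =>
    obtain ⟨c, hc⟩ := exists_mem_Ia_of_regular (iterate_regular hz (k + j))
    rw [← add_assoc, Function.iterate_succ_apply, Function.iterate_succ_apply', T_s2_T hc, ih]

theorem isCodingFrom_iff (z : ℝ × Bool) (m : ℕ) (u : List (Letter A)) :
    L.IsCodingFrom z m u ↔ L.Codes ((L.T)^[m] z) u := by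
  refine ⟨fun h i hi => ?_, fun h i => ?_⟩
  · rw [← Function.iterate_add_apply, add_comm]; exact h ⟨i, hi⟩
  · have := h i.1 i.2
    rwa [← Function.iterate_add_apply, add_comm] at this

theorem mem_Iw_iff {z : ℝ × Bool} (hz : z ∈ L.Ihat) (u : List (Letter A)) :
    z ∈ L.Iw u ↔ L.Codes z u := by
  simp only [Iw, mem_inter_iff, hz, true_and, mem_iInter, mem_preimage]
  exact ⟨fun h i hi => h ⟨i, hi⟩, fun h i => h i.1 i.2⟩

theorem mem_returnSet_iff {z : ℝ × Bool} (hz : z ∈ L.Ihat) (u : List (Letter A)) :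
    z ∈ L.Iw u ∪ s2 '' L.Iw u ↔ L.Codes z u ∨ L.Codes (s2 z) u := by
  rw [← mem_Iw_iff hz, ← mem_Iw_iff (s2_mem_Ihat hz)]
  refine or_congr Iff.rfl ⟨?_, fun h => ⟨_, h, s2_s2 z⟩⟩
  rintro ⟨y, hy, rfl⟩
  rwa [s2_s2]

theorem codes_append (z : ℝ × Bool) (u v : List (Letter A)) :
    L.Codes z (u ++ v) ↔ L.Codes z u ∧ L.Codes ((L.T)^[u.length] z) v := by
  constructor
  · refine fun h => ⟨fun i hi => ?_, fun i hi => ?_⟩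
    · have := h i (by simp; omega)
      rwa [List.getElem_append_left hi] at this
    · have := h (u.length + i) (by simp; omega)
      rw [List.getElem_append_right (by omega)] at this
      rw [← Function.iterate_add_apply, add_comm]
      simpa using this
  · rintro ⟨h1, h2⟩ i hi
    by_cases h : i < u.length
    · rw [List.getElem_append_left h]; exact h1 i h
    · rw [List.getElem_append_right (by omega)]
      have := h2 (i - u.length) (by simp at hi; omega)
      rwa [← Function.iterate_add_apply, Nat.sub_add_cancel (by omega)] at this

theorem Codes.eq_of_length_eq {z : ℝ × Bool} {u v : List (Letter A)} (hu : L.Codes z u)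
    (hv : L.Codes z v) (h : u.length = v.length) : u = v :=
  List.ext_getElem h fun i h1 h2 => Ia_unique (hu i h1) (hv i h2)

theorem Codes.wordInv {z : ℝ × Bool} (hz : z ∈ L.Ihat \ L.Ohat) {u : List (Letter A)}
    (hu : L.Codes z u) : L.Codes (s2 ((L.T)^[u.length] z)) (wordInv u) := by
  intro i hi
  rw [length_wordInv] at hi
  have e : u.length = (u.length - 1 - i + 1) + i := by omega
  have h1 : (L.T)^[i] (s2 ((L.T)^[u.length] z)) = L.s1 ((L.T)^[u.length - 1 - i] z) := by
    conv_lhs => rw [e]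
    rw [iterate_s2_iterate hz, Function.iterate_succ_apply', s2_T]
  rw [h1]
  simp only [LinInv.wordInv, List.getElem_reverse, List.getElem_map, List.length_map]
  exact s1_mem_Ia (hu _ (by omega))

/-- A word `v` never overlaps or touches an occurrence of `v⁻¹` that ends after `v` starts. -/
theorem Codes.no_overlap {x : ℝ × Bool} (hx : x ∈ L.Ihat \ L.Ohat) {v : List (Letter A)}
    (h1 : L.Codes x v) {k : ℕ} (h2 : L.Codes (s2 ((L.T)^[k] x)) v) : 2 * v.length ≤ k := by
  by_contra hk
  obtain ⟨j, hj | hj⟩ := Nat.even_or_odd' k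
  · subst hj
    have a := h1 j (by omega)
    have b := h2 j (by omega)
    rw [two_mul, iterate_s2_iterate hx] at b
    exact s2_notMem_Ia a b
  · have a := h1 j (by omega)
    have b := h2 j (by omega)
    obtain rfl : k = (j + 1) + j := by omega
    rw [iterate_s2_iterate hx,
      Function.iterate_succ_apply', s2_T] at b
    have := congrArg Prod.snd (Ia_unique b (s1_mem_Ia a))
    simp [Letter.inv] at this

theorem Codes.no_overlap_iterate {x : ℝ × Bool} (hx : x ∈ L.Ihat \ L.Ohat)
    {v : List (Letter A)} {p q : ℕ} (h1 : L.Codes ((L.T)^[p] x) v)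
    (h2 : L.Codes (s2 ((L.T)^[q] x)) v) (hpq : p ≤ q) : p + 2 * v.length ≤ q := by
  have := h1.no_overlap (iterate_regular hx p) (k := q - p) (by
    rwa [← Function.iterate_add_apply, Nat.sub_add_cancel hpq])
  omega

theorem Codes.eq_append {z : ℝ × Bool} {U x : List (Letter A)} (hU : L.Codes z U) {t : ℕ}
    (hx : L.Codes ((L.T)^[t] z) x) (ht : t + x.length ≤ U.length) :
    U = U.take t ++ x ++ U.drop (t + x.length) := by
  have e : U = U.take t ++ ((U.drop t).take x.length ++ U.drop (t + x.length)) := by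
    rw [← List.drop_drop, List.take_append_drop, List.take_append_drop]
  have h := hU
  rw [e, codes_append, codes_append, List.length_take, min_eq_left (by omega)] at h
  have := h.2.1.eq_of_length_eq hx (by simp; omega)
  rw [this] at e
  simpa using e

/-- Internal occurrences of `w` or `w⁻¹` in a coded word, read off the orbit. -/
theorem Codes.internal_factor_iff {z : ℝ × Bool} (hz : z ∈ L.Ihat \ L.Ohat)
    {U w : List (Letter A)} (hU : L.Codes z U) :
    (∃ p x s : List (Letter A), U = p ++ x ++ s ∧ x ∈ ({w, LinInv.wordInv w} : Set _) ∧
      p ≠ [] ∧ s ≠ []) ↔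
    ∃ t, (0 < t ∧ t + w.length < U.length ∧ L.Codes ((L.T)^[t] z) (LinInv.wordInv w)) ∨
      (w.length < t ∧ t < U.length ∧ L.Codes (s2 ((L.T)^[t] z)) (LinInv.wordInv w)) := by
  constructor
  · rintro ⟨p, x, s, rfl, hx, hp, hs⟩
    have hp := List.length_pos_iff.2 hp
    have hs := List.length_pos_iff.2 hs
    have h := ((codes_append _ _ _).1 ((codes_append _ _ _).1 hU).1).2
    rcases hx with rfl | rfl
    · refine ⟨x.length + p.length, Or.inr ⟨by omega, by simp; omega, ?_⟩⟩
      rw [Function.iterate_add_apply]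
      exact h.wordInv (iterate_regular hz _)
    · exact ⟨p.length, Or.inl ⟨hp, by simp [length_wordInv]; omega, h⟩⟩
  · rintro ⟨t, ⟨h0, h1, h⟩ | ⟨h0, h1, h⟩⟩
    · refine ⟨_, _, _, hU.eq_append h (by rw [length_wordInv]; omega), by simp, ?_, ?_⟩ <;>
        rw [← List.length_pos_iff] <;> simp [length_wordInv] <;> omega
    · have h := h.wordInv (s2_regular (iterate_regular hz t))
      rw [wordInv_wordInv, length_wordInv] at h
      have e : t = (t - w.length) + w.length := by omega
      rw [e, iterate_s2_iterate hz, s2_s2] at h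
      refine ⟨_, _, _, hU.eq_append h (by omega), by simp, ?_, ?_⟩ <;>
        rw [← List.length_pos_iff] <;> simp <;> omega

variable (L) in
/-- The word `U = a u b` coded by `z` starts with `w` or `w⁻¹` and ends with `w` or `w⁻¹`,
where `a = w` if `U` starts with `w` and `b = w⁻¹` if `U` ends with `w⁻¹`, and `a`, `b` are empty
otherwise. -/
structure Framed (w : List (Letter A)) (z : ℝ × Bool) (a u b : List (Letter A)) : Prop where
  regular : z ∈ L.Ihat \ L.Ohat
  codes : L.Codes z (a ++ u ++ b)
  left : a = w ∨ a = [] ∧ L.Codes z (wordInv w)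
  right : b = wordInv w ∨ b = [] ∧ L.Codes (s2 ((L.T)^[(a ++ u ++ b).length] z)) (wordInv w)

namespace Framed

variable {w a u b : List (Letter A)} {z : ℝ × Bool}

theorem codes_middle (h : L.Framed w z a u b) : L.Codes ((L.T)^[a.length] z) u :=
  ((codes_append _ _ _).1 ((codes_append _ _ _).1 h.codes).1).2

theorem beginning (h : L.Framed w z a u b) :
    (a.length = w.length ∧ L.Codes (s2 ((L.T)^[w.length] z)) (wordInv w)) ∨
      (a.length = 0 ∧ L.Codes ((L.T)^[0] z) (wordInv w)) := by
  rcases h.left with rfl | ⟨rfl, h'⟩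
  · exact Or.inl ⟨rfl,
      ((codes_append _ _ _).1 ((codes_append _ _ _).1 h.codes).1).1.wordInv h.regular⟩
  · exact Or.inr ⟨rfl, h'⟩

theorem ending (h : L.Framed w z a u b) :
    ((a ++ u ++ b).length = a.length + u.length + w.length ∧
        L.Codes ((L.T)^[a.length + u.length] z) (wordInv w)) ∨
      ((a ++ u ++ b).length = a.length + u.length ∧
        L.Codes (s2 ((L.T)^[a.length + u.length] z)) (wordInv w)) := by
  rcases h.right with rfl | ⟨rfl, h'⟩
  · refine Or.inl ⟨by simp [length_wordInv]; omega, ?_⟩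
    have := ((codes_append _ _ _).1 h.codes).2
    rwa [List.length_append] at this
  · refine Or.inr ⟨by simp, by simpa using h'⟩

open Classical in
theorem NN_eq (h : L.Framed w z a u b) (hne : w ≠ []) : NN w (a ++ u ++ b) = u := by
  have hm := List.length_pos_iff.2 hne
  have hbeginning : (if w <+: a ++ u ++ b then (a ++ u ++ b).drop w.length else a ++ u ++ b)
      = u ++ b := by
    rcases h.left with rfl | ⟨rfl, h'⟩
    · rw [if_pos (by simp)]; simp
    · rw [if_neg, List.nil_append]
      rintro ⟨r, hr⟩
      have hc := h.codes
      rw [← hr, codes_append] at hc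
      have := h'.no_overlap h.regular (hc.1.wordInv h.regular)
      rw [length_wordInv] at this
      omega
  have hNN : NN w (a ++ u ++ b) = if wordInv w <:+ u ++ b then
      (u ++ b).take ((u ++ b).length - w.length) else u ++ b := by
    unfold NN
    simp only [hbeginning]
  rw [hNN]
  rcases h.right with rfl | ⟨rfl, h'⟩
  · rw [if_pos (by simp)]; simp [length_wordInv]
  · rw [List.append_nil, if_neg]
    rintro ⟨r, rfl⟩
    have hc := ((codes_append _ _ _).1 h.codes_middle).2
    rw [← Function.iterate_add_apply] at hc
    have := hc.no_overlap_iterate h.regular h' (by simp; omega)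
    simp [length_wordInv] at this
    omega

theorem no_internal_iff (h : L.Framed w z a u b) (hne : w ≠ []) :
    (¬ ∃ p x s : List (Letter A), a ++ u ++ b = p ++ x ++ s ∧
      x ∈ ({w, wordInv w} : Set _) ∧ p ≠ [] ∧ s ≠ []) ↔
    ∀ k, 0 < k → k < u.length → (L.T)^[k] ((L.T)^[a.length] z) ∉
      L.Iw (wordInv w) ∪ s2 '' L.Iw (wordInv w) := by
  have hm := List.length_pos_iff.2 hne
  have key : ∀ p q, L.Codes ((L.T)^[p] z) (wordInv w) →
      L.Codes (s2 ((L.T)^[q] z)) (wordInv w) → p ≤ q → p + 2 * w.length ≤ q := by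
    intro p q h1 h2 hpq
    simpa [length_wordInv] using h1.no_overlap_iterate h.regular h2 hpq
  rw [h.codes.internal_factor_iff h.regular, not_iff_comm]
  push Not
  have hbeginning := h.beginning
  have hending := h.ending
  constructor
  · rintro ⟨k, hk0, hk, hK⟩
    rw [← Function.iterate_add_apply,
      mem_returnSet_iff (iterate_regular h.regular _).1] at hK
    refine ⟨k + a.length, ?_⟩
    rcases hK with hK | hK
    · refine Or.inl ⟨by omega, ?_, hK⟩
      rcases hending with ⟨e, -⟩ | ⟨e, h'⟩
      · omega
      · have := key _ _ hK h' (by omega)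
        omega
    · refine Or.inr ⟨?_, by omega, hK⟩
      rcases hbeginning with ⟨e, -⟩ | ⟨e, h'⟩
      · omega
      · have := key _ _ h' hK (by omega)
        omega
  · rintro ⟨t, ht⟩
    have ht' : a.length < t ∧ t < a.length + u.length := by
      rcases ht with ⟨h0, h1, hc⟩ | ⟨h0, h1, hc⟩
      · constructor
        · rcases hbeginning with ⟨e, h'⟩ | ⟨e, -⟩
          · by_contra hlt
            have := key _ _ hc h' (by omega)
            omega
          · omega
        · omega
      · constructor
        · omega
        · rcases hending with ⟨e, h'⟩ | ⟨e, -⟩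
          · by_contra hlt
            have := key _ _ h' hc (by omega)
            omega
          · omega
    refine ⟨t - a.length, by omega, by omega, ?_⟩
    rw [← Function.iterate_add_apply, Nat.sub_add_cancel (by omega),
      mem_returnSet_iff (iterate_regular h.regular _).1]
    exact ht.imp (fun h => h.2.2) (fun h => h.2.2)

theorem completeReturnWord (h : L.Framed w z a u b) (hne : w ≠ []) (hu : u ≠ []) :
    CompleteReturnWord L.lang {w, wordInv w} (a ++ u ++ b) := by
  have hm := List.length_pos_iff.2 hne
  have hn := List.length_pos_iff.2 hu
  have hlen : w.length < (a ++ u ++ b).length := by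
    rcases h.beginning with ⟨e, -⟩ | ⟨e, h1⟩ <;> rcases h.ending with ⟨e', -⟩ | ⟨e', h2⟩
    · omega
    · omega
    · omega
    · have := h1.no_overlap_iterate h.regular h2 (by omega)
      rw [length_wordInv] at this
      omega
  refine ⟨⟨z, h.regular, 0, (isCodingFrom_iff _ _ _).2 h.codes⟩, ?_, ?_⟩
  · rcases h.left with rfl | ⟨rfl, h'⟩
    · refine ⟨a, by simp, by simp, ?_⟩
      rintro e
      rw [← e] at hlen
      omega
    · have e := h.codes.eq_append (t := 0) h' (by rw [length_wordInv]; omega)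
      refine ⟨wordInv w, by simp, ?_, ?_⟩
      · rw [e]; simp
      · intro e
        rw [← e, length_wordInv] at hlen
        omega
  · rcases h.right with rfl | ⟨rfl, h'⟩
    · refine ⟨_, by simp, List.suffix_append _ _, ?_⟩
      intro e
      rw [← e, length_wordInv] at hlen
      omega
    · have hc := h'.wordInv (s2_regular (iterate_regular h.regular _))
      rw [wordInv_wordInv, length_wordInv] at hc
      have hcod := h.codes
      generalize a ++ u ++ [] = U at hc hcod hlen ⊢
      obtain ⟨n, hn⟩ : ∃ n, U.length = n + w.length := ⟨U.length - w.length, by omega⟩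
      rw [hn, iterate_s2_iterate h.regular, s2_s2] at hc
      refine ⟨w, by simp, ?_, ?_⟩
      · have e := hcod.eq_append hc (by omega)
        rw [← hn, List.drop_length, List.append_nil] at e
        exact ⟨_, e.symm⟩
      · rintro rfl
        omega

theorem returns (h : L.Framed w z a u b) :
    (L.T)^[a.length] z ∈ L.Iw (wordInv w) ∪ s2 '' L.Iw (wordInv w) ∧
    (L.T)^[u.length] ((L.T)^[a.length] z) ∈ L.Iw (wordInv w) ∪ s2 '' L.Iw (wordInv w) := by
  rw [← Function.iterate_add_apply, mem_returnSet_iff (iterate_regular h.regular _).1,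
    mem_returnSet_iff (iterate_regular h.regular _).1]
  constructor
  · rcases h.beginning with ⟨e, h'⟩ | ⟨e, h'⟩ <;> rw [e]
    · exact Or.inr h'
    · exact Or.inl h'
  · rw [add_comm]
    exact h.ending.imp (fun h => h.2) (fun h => h.2)

end Framed

/-- Every complete return word to `{w, w⁻¹}` is framed. -/
theorem exists_framed {w U : List (Letter A)} (hne : w ≠ [])
    (hU : CompleteReturnWord L.lang {w, wordInv w} U) :
    ∃ z a u b, U = a ++ u ++ b ∧ u ≠ [] ∧ L.Framed w z a u b := by
  have hm := List.length_pos_iff.2 hne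
  obtain ⟨⟨z₀, hz₀, m, hc⟩, ⟨p, hp, ⟨r, rfl⟩, hpU⟩, ⟨s, hs, ⟨t, ht⟩, hsU⟩⟩ := hU
  rw [isCodingFrom_iff] at hc
  have hz := iterate_regular hz₀ m
  generalize (L.T)^[m] z₀ = z at hc hz
  have hct := hc
  rw [← ht, codes_append] at hct
  have hcp := ((codes_append _ _ _).1 hc).1
  have hlen := congrArg List.length ht
  simp only [List.length_append] at hlen
  have hr : r ≠ [] := by rintro rfl; simp at hpU
  have ht0 : t ≠ [] := by rintro rfl; exact hsU (by simpa using ht)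
  have hend : s = w → L.Codes (s2 ((L.T)^[(p ++ r).length] z)) (wordInv w) := by
    rintro rfl
    have := hct.2.wordInv (iterate_regular hz _)
    rwa [← Function.iterate_add_apply, ← add_comm, ← List.length_append, ht] at this
  refine ⟨z, ?_⟩
  rcases hp with rfl | rfl <;> rcases hs with rfl | rfl
  · exact ⟨_, r, [], by simp, hr, hz, by simpa using hc, Or.inl rfl,
      Or.inr ⟨rfl, by simpa using hend rfl⟩⟩
  · have hlt : p.length < t.length := by
      by_contra hlt
      have := hct.2.no_overlap_iterate hz (hcp.wordInv hz) (by omega)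
      rw [length_wordInv] at this
      omega
    obtain ⟨u, rfl⟩ : p <+: t :=
      List.prefix_of_prefix_length_le ⟨r, rfl⟩ ⟨_, ht⟩ hlt.le
    refine ⟨p, u, _, ht.symm, ?_, hz, by rwa [ht], Or.inl rfl, Or.inl rfl⟩
    rintro rfl
    simp at hlt
  · exact ⟨[], wordInv s ++ r, [], by simp, by simp [hr], hz, by simpa using hc, Or.inr ⟨rfl, hcp⟩,
      Or.inr ⟨rfl, by simpa using hend rfl⟩⟩
  · exact ⟨[], t, _, by simp [ht], ht0, hz, by simpa [ht] using hc, Or.inr ⟨rfl, hcp⟩,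
      Or.inl rfl⟩

theorem natCast_eq_retTime_iff (X : Set (ℝ × Bool)) (x : ℝ × Bool) (n : ℕ) :
    (n : ℕ∞) = L.retTime X x ↔
      0 < n ∧ (L.T)^[n] x ∈ X ∧ ∀ k, 0 < k → k < n → (L.T)^[k] x ∉ X := by
  constructor
  · intro h
    have hne : {n : ℕ∞ | ∃ m : ℕ, n = (m : ℕ∞) ∧ 1 ≤ m ∧ (L.T)^[m] x ∈ X}.Nonempty := by
      by_contra hE
      rw [Set.not_nonempty_iff_eq_empty] at hE
      rw [retTime, hE, sInf_empty] at h
      exact ENat.natCast_ne_top n h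
    obtain ⟨m, hm, h1, h2⟩ := csInf_mem hne
    have : n = m := by
      have : (n : ℕ∞) = m := h.trans hm
      exact_mod_cast this
    subst this
    refine ⟨h1, h2, fun k hk hkn hX => ?_⟩
    have : (n : ℕ∞) ≤ k := h.trans_le (sInf_le ⟨k, rfl, hk, hX⟩)
    have : n ≤ k := by exact_mod_cast this
    omega
  · rintro ⟨h0, h1, h2⟩
    refine le_antisymm (le_sInf ?_) (sInf_le ⟨n, rfl, h0, h1⟩)
    rintro _ ⟨m, rfl, hm, hX⟩
    by_contra hlt
    exact h2 m hm (by exact_mod_cast not_le.1 hlt) hX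

/-- Every coded word joining two points of `K_w` extends to a framed word. -/
theorem exists_framed_of_returns {w u : List (Letter A)} {z : ℝ × Bool}
    (hz : z ∈ L.Ihat \ L.Ohat) (hu : L.Codes z u)
    (h0 : z ∈ L.Iw (wordInv w) ∪ s2 '' L.Iw (wordInv w))
    (h1 : (L.T)^[u.length] z ∈ L.Iw (wordInv w) ∪ s2 '' L.Iw (wordInv w)) :
    ∃ z₀ a b, (L.T)^[a.length] z₀ = z ∧ L.Framed w z₀ a u b := by
  rw [mem_returnSet_iff hz.1] at h0
  rw [mem_returnSet_iff (iterate_regular hz _).1] at h1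
  have hleft : ∃ z₀ ∈ L.Ihat \ L.Ohat, ∃ a, (L.T)^[a.length] z₀ = z ∧ L.Codes z₀ a ∧
      (a = w ∨ a = [] ∧ L.Codes z₀ (wordInv w)) := by
    rcases h0 with h0 | h0
    · exact ⟨z, hz, [], rfl, fun i hi => absurd hi (by simp), Or.inr ⟨rfl, h0⟩⟩
    · have h := h0.wordInv (s2_regular hz)
      rw [wordInv_wordInv, length_wordInv] at h
      refine ⟨_, s2_regular (iterate_regular (s2_regular hz) w.length), w, ?_, h, Or.inl rfl⟩
      have := iterate_s2_iterate (s2_regular hz) w.length 0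
      rw [zero_add] at this
      rw [this, Function.iterate_zero_apply, s2_s2]
  obtain ⟨z₀, hz₀, a, rfl, hca, ha⟩ := hleft
  have hau : L.Codes z₀ (a ++ u) := (codes_append _ _ _).2 ⟨hca, hu⟩
  rw [← Function.iterate_add_apply, add_comm, ← List.length_append] at h1
  rcases h1 with h1 | h1
  · exact ⟨z₀, a, wordInv w, rfl, hz₀, (codes_append _ _ _).2 ⟨hau, h1⟩, ha, Or.inl rfl⟩
  · exact ⟨z₀, a, [], rfl, hz₀, by simpa using hau, ha, Or.inr ⟨rfl, by simpa using h1⟩⟩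

end LinearInvolution

open LinearInvolution

/-- with `K_w = I_{w⁻¹} ∪ σ₂(I_{w⁻¹})`, the mixed first return
words to `w` are exactly the prefixes of length `ρ_{K_w}(z)` of the infinite
natural codings of points `z ∈ K_w ∖ Ô`. -/
theorem stmt_13 {A : Type*} [Fintype A] (L : LinearInvolution A)
    (hnc : ¬ L.HasConnection) (w : List (Letter A)) (hw : w ∈ L.lang)
    (hne : w ≠ []) :
    MR L.lang w =
      {u : List (Letter A) |
        ∃ z ∈ (L.Iw (wordInv w) ∪ s2 '' L.Iw (wordInv w)) \ L.Ohat,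
          L.IsCodingFrom z 0 u ∧
          (u.length : ℕ∞) =
            L.retTime (L.Iw (wordInv w) ∪ s2 '' L.Iw (wordInv w)) z} := by
  ext u
  simp only [mem_ofPred_eq, natCast_eq_retTime_iff, isCodingFrom_iff,
    Function.iterate_zero_apply]
  constructor
  · rintro ⟨U, hU, rfl⟩
    obtain ⟨z, a, u, b, rfl, hu, h⟩ := exists_framed hne hU.1
    rw [h.NN_eq hne]
    exact ⟨(L.T)^[a.length] z, ⟨h.returns.1, (iterate_regular h.regular _).2⟩, h.codes_middle,
      List.length_pos_iff.2 hu, h.returns.2, (h.no_internal_iff hne).1 hU.2⟩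
  · rintro ⟨z, ⟨hK, hO⟩, hc, hpos, hret, hmin⟩
    have hz : z ∈ L.Ihat := by
      rcases hK with h | ⟨y, h, rfl⟩
      · exact h.1
      · exact s2_mem_Ihat h.1
    obtain ⟨z₀, a, b, rfl, h⟩ := exists_framed_of_returns ⟨hz, hO⟩ hc hK hret
    exact ⟨a ++ u ++ b, ⟨h.completeReturnWord hne (List.length_pos_iff.1 hpos),
      (h.no_internal_iff hne).2 hmin⟩, h.NN_eq hne⟩

end LinInv
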